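/- arXiv:1212.1508 — 3 statements merged into one kernel-verified Lean document; each statement's English description precedes it below -/
import Mathlib

section
/- Let f_i : ℝⁿ → ℝ for i in a finite index set I = {1, …, p} each have a finite Dini directional derivative at x ∈ ℝⁿ in direction l ∈ ℝⁿ. Define f_max(y) := max_{i∈I} f_i(y) and f_min(y) := min_{i∈I} f_i(y). Then f_max and f_min have Dini directional derivatives at x in direction l, and f_max'(x;l) = max_{i∈I(x)} f_i'(x;l) and f_min'(x;l) = min_{i∈J(x)} f_i'(x;l), where I(x) := {i ∈ I | f_i(x) = f_max(x)} and J(x) := {i ∈ I | f_i(x) = f_min(x)}. -/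
open Filter Topology

/-- `f` has Dini directional derivative `d` at `x` in direction `l`. -/
def HasDiniDerivAt {n : ℕ} (f : EuclideanSpace ℝ (Fin n) → ℝ)
    (x l : EuclideanSpace ℝ (Fin n)) (d : ℝ) : Prop :=
  Tendsto (fun t : ℝ => (f (x + t • l) - f x) / t) (𝓝[>] 0) (𝓝 d)

theorem HasDiniDerivAt.neg {n : ℕ} {f : EuclideanSpace ℝ (Fin n) → ℝ}
    {x l : EuclideanSpace ℝ (Fin n)} {d : ℝ} (h : HasDiniDerivAt f x l d) :
    HasDiniDerivAt (fun y => -f y) x l (-d) := by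
  refine (Tendsto.neg h).congr fun t => ?_
  ring

/-- A function with a Dini derivative is continuous along the corresponding ray. -/
theorem HasDiniDerivAt.tendsto_ray {n : ℕ} {f : EuclideanSpace ℝ (Fin n) → ℝ}
    {x l : EuclideanSpace ℝ (Fin n)} {d : ℝ} (h : HasDiniDerivAt f x l d) :
    Tendsto (fun t : ℝ => f (x + t • l)) (𝓝[>] 0) (𝓝 (f x)) := by
  have hid : Tendsto (fun t : ℝ => t) (𝓝[>] 0) (𝓝 0) :=
    tendsto_nhdsWithin_of_tendsto_nhds tendsto_id
  have hlim := (Tendsto.mul h hid).add_const (f x)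
  rw [mul_zero, zero_add] at hlim
  refine hlim.congr' ?_
  filter_upwards [self_mem_nhdsWithin] with t ht
  have ht0 : t ≠ 0 := ne_of_gt ht
  field_simp
  ring

/-- The Dini derivative of a finite pointwise maximum is the largest Dini derivative among the
functions that attain the maximum at the base point. -/
theorem exists_hasDiniDerivAt_sup' {n : ℕ} {ι : Type*} {s : Finset ι} (hs : s.Nonempty)
    (f : ι → EuclideanSpace ℝ (Fin n) → ℝ) (x l : EuclideanSpace ℝ (Fin n)) (d : ι → ℝ)
    (hd : ∀ i ∈ s, HasDiniDerivAt (f i) x l (d i)) :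
    ∃ D : ℝ, HasDiniDerivAt (fun y => s.sup' hs (fun i => f i y)) x l D ∧
      IsGreatest {r : ℝ | ∃ i ∈ s, f i x = s.sup' hs (fun j => f j x) ∧ r = d i} D := by
  classical
  set M := s.sup' hs (fun j => f j x) with hM
  set A := s.filter (fun i => f i x = M)
  obtain ⟨k, hk, hkM⟩ := s.exists_mem_eq_sup' hs (fun j => f j x)
  have hkA : k ∈ A := Finset.mem_filter.2 ⟨hk, hkM.symm⟩
  have hne : A.Nonempty := ⟨k, hkA⟩
  refine ⟨A.sup' hne d, ?_, ?_, ?_⟩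
  · have hlim : Tendsto (fun t : ℝ => A.sup' hne fun i => (f i (x + t • l) - f i x) / t)
        (𝓝[>] 0) (𝓝 (A.sup' hne d)) :=
      Tendsto.finset_sup'_nhds_apply hne fun i hi => hd i (Finset.mem_filter.1 hi).1
    have hinactive : ∀ᶠ t : ℝ in 𝓝[>] 0, ∀ j ∈ s \ A, f j (x + t • l) < f k (x + t • l) := by
      refine (Filter.eventually_all_finset _).2 fun j hj => ?_
      obtain ⟨hjs, hjA⟩ := Finset.mem_sdiff.1 hj
      refine (hd j hjs).tendsto_ray.eventually_lt (hd k hk).tendsto_ray ?_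
      rw [← hkM]
      exact lt_of_le_of_ne (Finset.le_sup' (fun j => f j x) hjs)
        fun h => hjA (Finset.mem_filter.2 ⟨hjs, h⟩)
    refine hlim.congr' ?_
    filter_upwards [hinactive, self_mem_nhdsWithin] with t hlt ht
    have ht0 : (0 : ℝ) < t := ht
    apply le_antisymm
    · refine Finset.sup'_le hne _ fun i hi => ?_
      obtain ⟨his, hiM⟩ := Finset.mem_filter.1 hi
      rw [hiM]
      gcongr
      exact Finset.le_sup' (fun j => f j (x + t • l)) his
    · obtain ⟨j, hj, hjM⟩ := s.exists_mem_eq_sup' hs (fun j => f j (x + t • l))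
      have hjA : j ∈ A := by
        by_contra hjA
        refine (hlt j (Finset.mem_sdiff.2 ⟨hj, hjA⟩)).not_ge ?_
        rw [← hjM]
        exact Finset.le_sup' (fun j => f j (x + t • l)) hk
      rw [hjM, ← hM, ← (Finset.mem_filter.1 hjA).2]
      exact Finset.le_sup' (fun i => (f i (x + t • l) - f i x) / t) hjA
  · obtain ⟨i, hi, hiD⟩ := A.exists_mem_eq_sup' hne d
    obtain ⟨his, hiM⟩ := Finset.mem_filter.1 hi
    exact ⟨i, his, hiM, hiD⟩
  · rintro r ⟨i, his, hiM, rfl⟩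
    exact Finset.le_sup' d (Finset.mem_filter.2 ⟨his, hiM⟩)

theorem Finset.neg_sup'_neg {ι : Type*} {s : Finset ι} (hs : s.Nonempty) (g : ι → ℝ) :
    -s.sup' hs (fun i => -g i) = s.inf' hs g := by
  apply le_antisymm
  · refine Finset.le_inf' hs _ fun i hi => ?_
    linarith [Finset.le_sup' (fun i => -g i) hi]
  · rw [le_neg]
    exact Finset.sup'_le hs _ fun i hi => neg_le_neg (Finset.inf'_le g hi)

/-- Dini directional derivatives of pointwise max and min of finitely many
functions: the derivative of the max is the max of the derivatives over the
active index set `I(x)`, and similarly for the min over `J(x)`. -/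
theorem dini_deriv_max_min {n p : ℕ} (hp : 0 < p)
    (f : Fin p → EuclideanSpace ℝ (Fin n) → ℝ)
    (x l : EuclideanSpace ℝ (Fin n)) (d : Fin p → ℝ)
    (hd : ∀ i, HasDiniDerivAt (f i) x l (d i)) :
    (∃ dmax : ℝ,
      HasDiniDerivAt
        (fun y => Finset.univ.sup' ⟨⟨0, hp⟩, Finset.mem_univ _⟩ (fun i => f i y))
        x l dmax ∧
      IsGreatest {r : ℝ | ∃ i : Fin p,
        f i x = Finset.univ.sup' ⟨⟨0, hp⟩, Finset.mem_univ _⟩ (fun j => f j x) ∧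
        r = d i} dmax) ∧
    (∃ dmin : ℝ,
      HasDiniDerivAt
        (fun y => Finset.univ.inf' ⟨⟨0, hp⟩, Finset.mem_univ _⟩ (fun i => f i y))
        x l dmin ∧
      IsLeast {r : ℝ | ∃ i : Fin p,
        f i x = Finset.univ.inf' ⟨⟨0, hp⟩, Finset.mem_univ _⟩ (fun j => f j x) ∧
        r = d i} dmin) := by
  have hne : (Finset.univ : Finset (Fin p)).Nonempty := ⟨⟨0, hp⟩, Finset.mem_univ _⟩
  constructor
  · simpa only [Finset.mem_univ, true_and] using
      exists_hasDiniDerivAt_sup' hne f x l d fun i _ => hd i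
  · obtain ⟨D, hD, ⟨i, -, hi, hiD⟩, hub⟩ :=
      exists_hasDiniDerivAt_sup' hne (fun i y => -f i y) x l (fun i => -d i)
        fun i _ => (hd i).neg
    refine ⟨-D, ?_, ⟨i, ?_, by linarith⟩, ?_⟩
    · simpa only [Finset.neg_sup'_neg] using hD.neg
    · exact (neg_eq_iff_eq_neg.1 hi).trans (Finset.neg_sup'_neg hne fun j => f j x)
    · rintro r ⟨j, hj, rfl⟩
      have hj' := hj.trans (Finset.neg_sup'_neg hne fun j => f j x).symm
      exact neg_le.1 (hub ⟨j, Finset.mem_univ j, neg_eq_iff_eq_neg.2 hj', rfl⟩)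
end

section
/- There do not exist two sublinear functions g, h : ℝ² → ℝ (i.e. positively homogeneous and subadditive, hence convex) such that f(v) = g(v) − h(v) for all v ∈ ℝ², where f(x,y) := inf_{k ∈ ℕ, k ≥ 1} |x − y/k|. In particular, since f'(0; l) = f(l) for all l, the function f is not quasidifferentiable at the origin. -/
/-- `f(x, y) := inf_{k ∈ ℕ, k ≥ 1} |x - y/k|` on the Euclidean plane. -/
noncomputable def infDistFun (p : EuclideanSpace ℝ (Fin 2)) : ℝ :=
  ⨅ k : ℕ+, |p 0 - p 1 / (k : ℝ)|

theorem infDistFun_nat_inv (n : ℕ) : infDistFun !₂[1 / ((n : ℝ) + 1), 1] = 0 := by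
  refine le_antisymm ?_ (Real.iInf_nonneg fun _ => abs_nonneg _)
  refine (ciInf_le ⟨0, ?_⟩ n.succPNat).trans (by simp)
  rintro _ ⟨k, rfl⟩
  exact abs_nonneg _

theorem infDistFun_midpoint_nat_inv (n : ℕ) :
    infDistFun !₂[(1 / ((n : ℝ) + 1) + 1 / ((n : ℝ) + 2)) / 2, 1] =
      (1 / ((n : ℝ) + 1) - 1 / ((n : ℝ) + 2)) / 2 := by
  have hlt : 1 / ((n : ℝ) + 2) < 1 / ((n : ℝ) + 1) := by gcongr; norm_num
  refine le_antisymm ?_ (le_ciInf fun k => ?_)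
  · refine (ciInf_le ⟨0, ?_⟩ n.succPNat).trans ?_
    · rintro _ ⟨k, rfl⟩
      exact abs_nonneg _
    · simp only [Matrix.cons_val_zero, Matrix.cons_val_one, Nat.succPNat_coe, Nat.succ_eq_add_one,
        Nat.cast_add, Nat.cast_one, abs_le]
      constructor <;> linarith
  · simp only [Matrix.cons_val_zero, Matrix.cons_val_one]
    have hk : (0 : ℝ) < (k : ℕ) := by exact_mod_cast k.pos
    rcases le_or_gt (k : ℕ) (n + 1) with h | h
    · have h' : ((k : ℕ) : ℝ) ≤ n + 1 := by exact_mod_cast h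
      have := one_div_le_one_div_of_le hk h'
      exact le_abs.2 (Or.inr (by linarith))
    · have h' : (n : ℝ) + 2 ≤ (k : ℕ) := by exact_mod_cast h
      have := one_div_le_one_div_of_le (by positivity) h'
      exact le_abs.2 (Or.inl (by linarith))

/-- The restriction of a sublinear function on the plane to the line `y = 1` is convex. -/
theorem convexOn_line_of_sublinear {g : EuclideanSpace ℝ (Fin 2) → ℝ}
    (hg : ∀ t : ℝ, 0 ≤ t → ∀ v, g (t • v) = t * g v) (hg' : ∀ v w, g (v + w) ≤ g v + g w) :
    ConvexOn ℝ Set.univ fun x : ℝ => g !₂[x, 1] := by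
  refine ⟨convex_univ, fun x _ y _ a b ha hb hab => ?_⟩
  have hsplit : (!₂[a • x + b • y, 1] : EuclideanSpace ℝ (Fin 2)) =
      a • !₂[x, 1] + b • !₂[y, 1] := by
    ext i
    fin_cases i <;> simp [hab]
  calc g !₂[a • x + b • y, 1] ≤ g (a • !₂[x, 1]) + g (b • !₂[y, 1]) := hsplit ▸ hg' _ _
    _ = a • g !₂[x, 1] + b • g !₂[y, 1] := by rw [hg a ha, hg b hb, smul_eq_mul, smul_eq_mul]

/-- If `G` and `H` are convex and `G - H` is `|· - y|` at `v < y < w`, then the slopes of `G`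
increase by at least `2` across `y`. -/
theorem slope_add_two_le_of_convexOn {G H : ℝ → ℝ} (hG : ConvexOn ℝ Set.univ G)
    (hH : ConvexOn ℝ Set.univ H) {u v y w : ℝ} (huv : u < v) (hvy : v < y) (hyw : y < w)
    (hv : G v - H v = y - v) (hy : G y - H y = 0) (hw : G w - H w = w - y) :
    (G v - G u) / (v - u) + 2 ≤ (G w - G y) / (w - y) := by
  have hG' := hG.slope_mono_adjacent (Set.mem_univ u) (Set.mem_univ y) huv hvy
  have hH' := hH.slope_mono_adjacent (Set.mem_univ v) (Set.mem_univ w) hvy hyw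
  have hleft : (G y - G v) / (y - v) = (H y - H v) / (y - v) - 1 := by
    have := (sub_pos.2 hvy).ne'
    field_simp
    linarith
  have hright : (G w - G y) / (w - y) = (H w - H y) / (w - y) + 1 := by
    have := (sub_pos.2 hyw).ne'
    field_simp
    linarith
  linarith

/-- The function `f(x,y) = inf_{k ≥ 1} |x - y/k|` is not a difference of two
sublinear (positively homogeneous and subadditive) functions on `ℝ²`; since
`f'(0; l) = f(l)`, this means `f` is not quasidifferentiable at the origin. -/
theorem infDistFun_not_difference_of_sublinear :
    ¬ ∃ g h : EuclideanSpace ℝ (Fin 2) → ℝ,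
      (∀ t : ℝ, 0 ≤ t → ∀ v, g (t • v) = t * g v) ∧
      (∀ v w, g (v + w) ≤ g v + g w) ∧
      (∀ t : ℝ, 0 ≤ t → ∀ v, h (t • v) = t * h v) ∧
      (∀ v w, h (v + w) ≤ h v + h w) ∧
      (∀ v, infDistFun v = g v - h v) := by
  rintro ⟨g, h, hg, hg', hh, hh', hf⟩
  have hG := convexOn_line_of_sublinear hg hg'
  have hH := convexOn_line_of_sublinear hh hh'
  set G : ℝ → ℝ := fun x => g !₂[x, 1]
  set H : ℝ → ℝ := fun x => h !₂[x, 1]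
  let p : ℕ → ℝ := fun n => 1 / ((n : ℝ) + 1)
  let q : ℕ → ℝ := fun n => (p n + p (n + 1)) / 2
  have hp (n : ℕ) : p (n + 1) = 1 / ((n : ℝ) + 2) := by
    simp only [p]
    push_cast
    ring_nf
  have hp_pos (n : ℕ) : 0 < p n := by positivity
  have hp_lt (n : ℕ) : p (n + 1) < p n := by
    rw [hp]
    simp only [p]
    gcongr
    norm_num
  have hq (n : ℕ) : q n = (p n + p (n + 1)) / 2 := rfl
  have hp_lt_q (n : ℕ) : p (n + 1) < q n := by linarith [hp_lt n, hq n]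
  have hq_lt_p (n : ℕ) : q n < p n := by linarith [hp_lt n, hq n]
  have hGHp (n : ℕ) : G (p n) - H (p n) = 0 := (hf _).symm.trans (infDistFun_nat_inv n)
  have hGHq (n : ℕ) : G (q n) - H (q n) = (p n - p (n + 1)) / 2 := by
    have := infDistFun_midpoint_nat_inv n
    rw [← hp n] at this
    exact (hf _).symm.trans this
  let s : ℕ → ℝ := fun n => (G (q n) - G (p (n + 1))) / (q n - p (n + 1))
  have hstep (n : ℕ) : s (n + 1) + 2 ≤ s n := by
    refine slope_add_two_le_of_convexOn hG hH (hp_lt_q _) (hq_lt_p _) (hp_lt_q _) ?_ (hGHp _) ?_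
    · linarith [hGHq (n + 1), hq (n + 1)]
    · linarith [hGHq n, hq n]
  have hdecay (n : ℕ) : s n + 2 * n ≤ s 0 := by
    induction n with
    | zero => simp
    | succ n ih => push_cast; linarith [hstep n]
  have hbelow (n : ℕ) : (G 0 - G (-1)) / (0 - -1) ≤ s n :=
    (hG.slope_mono_adjacent (Set.mem_univ _) (Set.mem_univ _) (by norm_num) (hp_pos (n + 1))).trans
      (hG.slope_mono_adjacent (Set.mem_univ _) (Set.mem_univ _) (hp_pos (n + 1)) (hp_lt_q n))
  obtain ⟨n, hn⟩ := exists_nat_gt (s 0 - (G 0 - G (-1)) / (0 - -1))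
  linarith [hdecay n, hbelow n, n.cast_nonneg (α := ℝ)]
end

section
/- Let φ : ℝ → ℝ be defined by φ(t) := inf_{k ∈ ℕ, k ≥ 1} |t − 1/k|. There is no open interval I containing 0 and no pair of convex functions g, h : I → ℝ such that φ(t) = g(t) − h(t) for all t ∈ I; i.e. φ is not a DC (difference of convex) function on any neighborhood of 0. -/
/-- `φ(t) := inf_{k ∈ ℕ, k ≥ 1} |t - 1/k|`. -/
noncomputable def phiInf (t : ℝ) : ℝ :=
  ⨅ k : ℕ+, |t - 1 / (k : ℝ)|

theorem phiInf_nonneg (t : ℝ) : 0 ≤ phiInf t :=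
  Real.iInf_nonneg fun _ => abs_nonneg _

theorem phiInf_one_div_succ (n : ℕ) : phiInf (1 / ((n : ℝ) + 1)) = 0 := by
  refine le_antisymm ?_ (phiInf_nonneg _)
  have hbdd : BddBelow (Set.range fun k : ℕ+ => |1 / ((n : ℝ) + 1) - 1 / (k : ℝ)|) :=
    ⟨0, by rintro _ ⟨k, rfl⟩; exact abs_nonneg _⟩
  refine (ciInf_le hbdd n.succPNat).trans ?_
  simp

/-- At the midpoint of two consecutive zeros, `phiInf` is at least half their distance. -/
theorem half_gap_le_phiInf_midpoint (n : ℕ) :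
    (1 / ((n : ℝ) + 1) - 1 / ((n : ℝ) + 2)) / 2 ≤
      phiInf ((1 / ((n : ℝ) + 2) + 1 / ((n : ℝ) + 1)) / 2) := by
  refine le_ciInf fun k => ?_
  have hk : (0 : ℝ) < (k : ℝ) := by exact_mod_cast k.pos
  rcases Nat.lt_or_ge (n + 1) k with h | h
  · have h' : (n : ℝ) + 2 ≤ (k : ℝ) := by exact_mod_cast h
    have := one_div_le_one_div_of_le (by positivity) h'
    exact le_trans (by linarith) (le_abs_self _)
  · have h' : (k : ℝ) ≤ (n : ℝ) + 1 := by exact_mod_cast h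
    have := one_div_le_one_div_of_le hk h'
    exact le_trans (by linarith) (neg_le_abs _)

/-- If `g - h` has a tent of slopes `1` and `-1` over `[x, y]`, then convexity of `g` forces the
slope of `h` to jump by at least `2` at the midpoint. -/
theorem ConvexOn.slope_add_two_le_of_tent {s : Set ℝ} {g h : ℝ → ℝ} (hg : ConvexOn ℝ s g)
    {x y : ℝ} (hx : x ∈ s) (hy : y ∈ s) (hxy : x < y)
    (hgx : g x = h x) (hgy : g y = h y)
    (hgm : (y - x) / 2 ≤ g ((x + y) / 2) - h ((x + y) / 2)) :
    (h ((x + y) / 2) - h x) / ((x + y) / 2 - x) + 2 ≤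
      (h y - h ((x + y) / 2)) / (y - (x + y) / 2) := by
  have key := hg.slope_mono_adjacent hx hy (y := (x + y) / 2) (by linarith) (by linarith)
  have hd : 0 < (y - x) / 2 := by linarith
  rw [show (x + y) / 2 - x = (y - x) / 2 by ring,
    show y - (x + y) / 2 = (y - x) / 2 by ring] at key ⊢
  rw [div_le_div_iff_of_pos_right hd] at key
  rw [div_add' _ _ _ hd.ne', div_le_div_iff_of_pos_right hd]
  linarith

/-- `φ(t) = inf_{k ≥ 1} |t - 1/k|` is not DC on any open interval around `0`:
there is no open interval `(a, b) ∋ 0` on which `φ` is a difference of two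
convex functions. -/
theorem phiInf_not_DC_near_zero :
    ¬ ∃ (a b : ℝ) (g h : ℝ → ℝ), a < 0 ∧ 0 < b ∧
      ConvexOn ℝ (Set.Ioo a b) g ∧ ConvexOn ℝ (Set.Ioo a b) h ∧
      ∀ t ∈ Set.Ioo a b, phiInf t = g t - h t := by
  rintro ⟨a, b, g, h, ha, hb, hg, hh, hφ⟩
  obtain ⟨N, hN⟩ := exists_nat_one_div_lt hb
  let p : ℕ → ℝ := fun k => 1 / (((N + k : ℕ) : ℝ) + 1)
  let m : ℕ → ℝ := fun k => (p (k + 1) + p k) / 2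
  let S : ℕ → ℝ := fun k => (h (m k) - h (p (k + 1))) / (m k - p (k + 1))
  have hp0 (k : ℕ) : 0 < p k := by positivity
  have hp_lt (k : ℕ) : p (k + 1) < p k :=
    one_div_lt_one_div_of_lt (by positivity) (by push_cast; linarith)
  have hp_le (k : ℕ) : p k ≤ 1 / ((N : ℝ) + 1) :=
    one_div_le_one_div_of_le (by positivity) (by
      push_cast; linarith [(Nat.cast_nonneg k : (0 : ℝ) ≤ k)])
  have hp (k : ℕ) : p k ∈ Set.Ioo a b := ⟨ha.trans (hp0 k), (hp_le k).trans_lt hN⟩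
  have hpm (k : ℕ) : p (k + 1) < m k := by dsimp only [m]; linarith [hp_lt k]
  have hmp (k : ℕ) : m k < p k := by dsimp only [m]; linarith [hp_lt k]
  have hm (k : ℕ) : m k ∈ Set.Ioo a b :=
    ⟨(hp (k + 1)).1.trans (hpm k), (hmp k).trans (hp k).2⟩
  have hgp (k : ℕ) : g (p k) = h (p k) := by
    have := hφ _ (hp k)
    rw [phiInf_one_div_succ] at this
    linarith
  have hgm (k : ℕ) : (p k - p (k + 1)) / 2 ≤ g (m k) - h (m k) := by
    rw [← hφ _ (hm k)]
    have hsucc : p (k + 1) = 1 / (((N + k : ℕ) : ℝ) + 2) := by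
      dsimp only [p]; push_cast; ring
    dsimp only [m]
    rw [hsucc]
    exact half_gap_le_phiInf_midpoint (N + k)
  have hstep (k : ℕ) : S (k + 1) + 2 ≤ S k :=
    (hg.slope_add_two_le_of_tent (hp (k + 2)) (hp (k + 1)) (hp_lt (k + 1)) (hgp _) (hgp _)
      (hgm (k + 1))).trans
      (hh.slope_mono_adjacent (hm (k + 1)) (hm k) (hmp (k + 1)) (hpm k))
  have hlin (k : ℕ) : S k ≤ S 0 - 2 * k := by
    induction k with
    | zero => simp
    | succ k ih => push_cast; linarith [hstep k]
  have hlower (k : ℕ) : (h 0 - h (a / 2)) / (0 - a / 2) ≤ S k :=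
    (hh.slope_mono_adjacent ⟨by linarith, by linarith⟩ (hp (k + 1)) (by linarith)
      (hp0 (k + 1))).trans
      (hh.slope_mono_adjacent ⟨ha, hb⟩ (hm k) (hp0 (k + 1)) (hpm k))
  obtain ⟨k, hk⟩ := exists_nat_gt (S 0 - (h 0 - h (a / 2)) / (0 - a / 2))
  linarith [hlin k, hlower k, (Nat.cast_nonneg k : (0 : ℝ) ≤ k)]
end
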